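/- For all 0 < k < n, the polynomial O(n,k)^2 − O(n,k−1)·O(n,k+1) has non-negative coefficients as a polynomial in q and t ((q,t)-log-concavity of over-(q,t)-binomial coefficients), where O(n,j) is the over-(q,t)-binomial coefficient for the (n−j)×j rectangle. -/

import Mathlib

open Finset Polynomial

/-- `overp m n k N` is the number of overpartitions of `N` with `k` overlined parts,
largest part `≤ m`, and at most `n` parts. An overpartition is a partition together
with a subset of its (distinct) part sizes which are overlined. -/
noncomputable def overp (m n k N : ℕ) : ℕ :=
  Nat.card {p : Nat.Partition N × Finset ℕ //
    (∀ i ∈ p.1.parts, i ≤ m) ∧ Multiset.card p.1.parts ≤ n ∧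
    p.2 ⊆ p.1.parts.toFinset ∧ p.2.card = k}

/-- The over-(q,t)-binomial coefficient for the `m × n` rectangle, evaluated at
elements `q t` of a commutative ring. -/
noncomputable def Oqt {R : Type*} [CommRing R] (q t : R) (m n : ℕ) : R :=
  ∑ N ∈ range (m * n + 1), ∑ k ∈ range (n + 1), (overp m n k N : R) * t ^ k * q ^ N

/-- The over-(q,t)-binomial coefficient for overpartitions fitting inside an
(a-b) x b rectangle, as a polynomial in q (outer variable) and t (inner variable). -/
noncomputable def OqtP (a b : ℕ) : Polynomial (Polynomial ℤ) :=
  ∑ N ∈ range ((a - b) * b + 1), ∑ k ∈ range (b + 1),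
    Polynomial.C (Polynomial.C (overp (a - b) b k N : ℤ) * Polynomial.X ^ k) * Polynomial.X ^ N

/-- Overpartitions in an `m × n` box, built recursively. -/
def boxA : ℕ → ℕ → Finset (Multiset ℕ × Finset ℕ)
  | 0, _ => {(0, ∅)}
  | _ + 1, 0 => {(0, ∅)}
  | m + 1, n + 1 => (boxA m (n + 1) ∪
      (boxA (m + 1) n).image (fun x => ((m + 1) ::ₘ x.1, x.2))) ∪
      (boxA m n).image (fun x => ((m + 1) ::ₘ x.1, insert (m + 1) x.2))

theorem mem_boxA (m n : ℕ) (s : Multiset ℕ) (T : Finset ℕ) :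
    (s, T) ∈ boxA m n ↔ (∀ i ∈ s, 0 < i ∧ i ≤ m) ∧ Multiset.card s ≤ n ∧ T ⊆ s.toFinset := by
  induction m, n using boxA.induct generalizing s T with
  | case1 n =>
    simp only [boxA, Finset.mem_singleton, Prod.mk.injEq]
    constructor
    · rintro ⟨rfl, rfl⟩; simp
    · rintro ⟨h1, h2, h3⟩
      have : s = 0 := Multiset.eq_zero_of_forall_notMem fun i hi => by
        have := h1 i hi; omega
      subst this
      simpa using h3
  | case2 m =>
    simp only [boxA, Finset.mem_singleton, Prod.mk.injEq]
    constructor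
    · rintro ⟨rfl, rfl⟩; simp
    · rintro ⟨h1, h2, h3⟩
      have : s = 0 := by simpa using h2
      subst this
      simpa using h3
  | case3 m n ih1 ih2 ih3 =>
    simp only [boxA, Finset.mem_union, Finset.mem_image, Prod.exists, ih1, ih2, ih3,
      Prod.mk.injEq]
    constructor
    · rintro ((⟨h1, h2, h3⟩ | ⟨s', T', ⟨h1, h2, h3⟩, rfl, rfl⟩) | ⟨s', T', ⟨h1, h2, h3⟩, rfl, rfl⟩)
      · exact ⟨fun i hi => ⟨(h1 i hi).1, by have := (h1 i hi).2; omega⟩, h2, h3⟩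
      · refine ⟨?_, by simpa using h2, ?_⟩
        · intro i hi
          rcases Multiset.mem_cons.1 hi with rfl | hi
          · omega
          · exact h1 i hi
        · intro i hi
          have := h3 hi
          simp at this ⊢
          exact Or.inr this
      · refine ⟨?_, by simpa using h2, ?_⟩
        · intro i hi
          rcases Multiset.mem_cons.1 hi with rfl | hi
          · omega
          · have := h1 i hi
            omega
        · intro i hi
          rcases Finset.mem_insert.1 hi with rfl | hi
          · simp
          · have := h3 hi
            simp at this ⊢
            exact Or.inr this
    · rintro ⟨h1, h2, h3⟩
      by_cases hm : m + 1 ∈ s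
      · obtain ⟨s', rfl⟩ := Multiset.exists_cons_of_mem hm
        have h1' : ∀ i ∈ s', 0 < i ∧ i ≤ m + 1 := fun i hi => h1 i (Multiset.mem_cons_of_mem hi)
        have h2' : Multiset.card s' ≤ n := by simpa using h2
        by_cases hs : m + 1 ∈ s'
        · refine Or.inl (Or.inr ⟨s', T, ⟨h1', h2', ?_⟩, rfl, rfl⟩)
          intro i hi
          have := h3 hi
          simp at this ⊢
          rcases this with rfl | h
          · exact hs
          · exact h
        · by_cases hT : m + 1 ∈ T
          · refine Or.inr ⟨s', T.erase (m + 1), ⟨?_, h2', ?_⟩, rfl, Finset.insert_erase hT⟩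
            · intro i hi
              have := h1' i hi
              have h : i ≠ m + 1 := by rintro rfl; exact hs hi
              omega
            · intro i hi
              have h := h3 (Finset.mem_of_mem_erase hi)
              have h' := Finset.ne_of_mem_erase hi
              simp at h ⊢
              tauto
          · refine Or.inl (Or.inr ⟨s', T, ⟨h1', h2', ?_⟩, rfl, rfl⟩)
            intro i hi
            have h := h3 hi
            have h' : i ≠ m + 1 := by rintro rfl; exact hT hi
            simp at h ⊢
            tauto
      · refine Or.inl (Or.inl ⟨?_, h2, h3⟩)
        intro i hi
        have := h1 i hi
        have h : i ≠ m + 1 := by rintro rfl; exact hm hi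
        omega

section ring
variable {R : Type*} [CommRing R]

/-- Generating function of the box. -/
noncomputable def boxG (q t : R) (m n : ℕ) : R :=
  ∑ x ∈ boxA m n, t ^ x.2.card * q ^ x.1.sum

theorem boxG_zero_left (q t : R) (n : ℕ) : boxG q t 0 n = 1 := by
  simp [boxG, boxA]

theorem boxG_zero_right (q t : R) (m : ℕ) : boxG q t m 0 = 1 := by
  cases m <;> simp [boxG, boxA]

theorem boxG_rec (q t : R) (m n : ℕ) : boxG q t (m + 1) (n + 1) =
    boxG q t m (n + 1) + q ^ (m + 1) * boxG q t (m + 1) n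
      + t * q ^ (m + 1) * boxG q t m n := by
  have hnot : ∀ {k : ℕ} {s : Multiset ℕ} {T : Finset ℕ}, (s, T) ∈ boxA m k →
      m + 1 ∉ s ∧ m + 1 ∉ T := by
    intro k s T h
    rw [mem_boxA] at h
    have hs : m + 1 ∉ s := fun h' => by have := h.1 _ h'; omega
    exact ⟨hs, fun h' => hs (by simpa using h.2.2 h')⟩
  unfold boxG
  rw [boxA, Finset.sum_union, Finset.sum_union, Finset.sum_image, Finset.sum_image,
    Finset.mul_sum, Finset.mul_sum]
  · congr 1
    · congr 1
      refine Finset.sum_congr rfl ?_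
      rintro ⟨s, T⟩ h
      simp [pow_add]; ring
    · refine Finset.sum_congr rfl ?_
      rintro ⟨s, T⟩ h
      simp [Finset.card_insert_of_notMem (hnot h).2, pow_add]; ring
  · rintro ⟨s, T⟩ h ⟨s', T'⟩ h' he
    simp only [Prod.mk.injEq, Multiset.cons_inj_right] at he ⊢
    refine ⟨he.1, ?_⟩
    rw [← Finset.erase_insert (hnot h).2, he.2, Finset.erase_insert (hnot h').2]
  · rintro ⟨s, T⟩ h ⟨s', T'⟩ h' he
    simpa using he
  · rw [Finset.disjoint_left]
    rintro ⟨s, T⟩ h h'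
    simp only [Finset.mem_image, Prod.exists, Prod.mk.injEq] at h'
    obtain ⟨s', T', -, rfl, -⟩ := h'
    exact (hnot h).1 (by simp)
  · rw [Finset.disjoint_left]
    rintro ⟨s, T⟩ h h'
    simp only [Finset.mem_image, Prod.exists, Prod.mk.injEq] at h'
    obtain ⟨s', T', hs, rfl, rfl⟩ := h'
    rcases Finset.mem_union.1 h with h | h
    · exact (hnot h).1 (by simp)
    · simp only [Finset.mem_image, Prod.exists, Prod.mk.injEq] at h
      obtain ⟨s'', T'', h0, h1, rfl⟩ := h
      rw [Multiset.cons_inj_right] at h1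
      subst h1
      rw [mem_boxA] at h0
      have := h0.2.2 (Finset.mem_insert_self _ _)
      exact (hnot hs).1 (by simpa using this)

theorem boxG_rec' (q t : R) (m n : ℕ) : boxG q t (m + 1) (n + 1) =
    boxG q t (m + 1) n + q ^ (n + 1) * boxG q t m (n + 1)
      + t * q ^ (n + 1) * boxG q t m n := by
  induction m generalizing n with
  | zero =>
    induction n with
    | zero => simp [boxG_rec, boxG_zero_left, boxG_zero_right]
    | succ n ih =>
      rw [boxG_rec]
      rw [boxG_rec q t 0 n] at ih ⊢
      simp only [boxG_zero_left] at ih ⊢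
      linear_combination q * ih
  | succ m ihm =>
    induction n with
    | zero =>
      have h := ihm 0
      have h1 := boxG_rec q t (m + 1) 0
      have h2 := boxG_rec q t m 0
      simp only [boxG_zero_right] at *
      linear_combination h + h1 - q * h2
    | succ n ihn =>
      linear_combination ihm (n + 1) + q ^ (m + 2) * ihn + t * q ^ (m + 2) * ihm n
        + boxG_rec q t (m + 1) (n + 1) - boxG_rec q t (m + 1) n
        - q ^ (n + 2) * boxG_rec q t m (n + 1) - t * q ^ (n + 2) * boxG_rec q t m n

end ring

/-- Nonnegative coefficients. -/
def NNc (p : Polynomial (Polynomial ℤ)) : Prop := ∀ N K : ℕ, 0 ≤ (p.coeff N).coeff K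

theorem NNc.add {p r : Polynomial (Polynomial ℤ)} (hp : NNc p) (hr : NNc r) : NNc (p + r) := fun N K => by
  simpa using add_nonneg (hp N K) (hr N K)

theorem NNc.mul {p r : Polynomial (Polynomial ℤ)} (hp : NNc p) (hr : NNc r) : NNc (p * r) := fun N K => by
  rw [Polynomial.coeff_mul, Polynomial.finsetSum_coeff]
  refine Finset.sum_nonneg fun x _ => ?_
  rw [Polynomial.coeff_mul]
  exact Finset.sum_nonneg fun y _ => mul_nonneg (hp _ _) (hr _ _)

theorem NNc.zero : NNc 0 := fun N K => by simp

theorem NNc.one : NNc 1 := fun N K => by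
  rw [Polynomial.coeff_one]; split_ifs
  · rw [Polynomial.coeff_one]; split_ifs <;> simp
  · simp

theorem NNc.var : NNc X := fun N K => by
  rw [Polynomial.coeff_X]; split_ifs
  · rw [Polynomial.coeff_one]; split_ifs <;> simp
  · simp

theorem NNc.CX : NNc (C X) := fun N K => by
  rw [Polynomial.coeff_C]; split_ifs
  · rw [Polynomial.coeff_X]; split_ifs <;> simp
  · simp

theorem NNc.pow {p : Polynomial (Polynomial ℤ)} (hp : NNc p) (n : ℕ) : NNc (p ^ n) := by
  induction n with
  | zero => simpa using NNc.one
  | succ n ih => rw [pow_succ]; exact ih.mul hp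

theorem NNc.sum {ι : Type*} (s : Finset ι) (f : ι → Polynomial (Polynomial ℤ)) (h : ∀ i ∈ s, NNc (f i)) :
    NNc (∑ i ∈ s, f i) := by
  classical
  induction s using Finset.induction_on with
  | empty => simpa using NNc.zero
  | insert a s ha ih =>
    rw [Finset.sum_insert ha]
    exact (h a (by simp)).add (ih fun i hi => h i (by simp [hi]))

/-- Two-by-two minors positivity. -/
def TPc (f g : ℕ → Polynomial (Polynomial ℤ)) : Prop :=
  ∀ i j, j ≤ i → NNc (f i * g (j + 1) - f (i + 1) * g j)

theorem TPc.step {e f g : ℕ → Polynomial (Polynomial ℤ)} {c d : Polynomial (Polynomial ℤ)} (hc : NNc c) (hd : NNc d)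
    (hf0 : f 0 = 0) (hg0 : g 0 = 0)
    (hg : ∀ j, g (j + 1) = f (j + 1) + d * f j + c * g j) (h : TPc e f) : TPc e g := by
  intro i j
  induction j with
  | zero =>
    intro hj
    have := h i 0 hj
    rw [hg]; simpa [hg0, hf0] using this
  | succ j ih =>
    intro hj
    have h1 := h i (j + 1) hj
    have h2 := hd.mul (h i j (by omega))
    have h3 := hc.mul (ih (by omega))
    convert (h1.add h2).add h3 using 1
    rw [hg (j + 1), hg j]
    rw [show c * (e i * (f (j+1) + d * f j + c * g j) - e (i+1) * g j)
      = c * (e i * (f (j+1) + d * f j + c * g j)) - c * (e (i+1) * g j) by ring]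
    ring

theorem TPc.step_self {f g : ℕ → Polynomial (Polynomial ℤ)} {c d : Polynomial (Polynomial ℤ)} (hc : NNc c) (hd : NNc d)
    (hg0 : g 0 = 0)
    (hg : ∀ j, g (j + 1) = f (j + 1) + d * f j + c * g j) (h : TPc f g) : TPc g g := by
  intro i
  induction i with
  | zero =>
    intro j hj
    obtain rfl : j = 0 := by omega
    simpa [hg0] using NNc.zero
  | succ i ih =>
    intro j hj
    rcases Nat.lt_or_ge i j with hlt | hle
    · obtain rfl : j = i + 1 := by omega
      have : g (i + 1) * g (i + 1 + 1) - g (i + 1 + 1) * g (i + 1) = 0 := by ring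
      rw [this]; exact NNc.zero
    · have h1 := h (i + 1) j hj
      have h2 := hd.mul (h i j hle)
      have h3 := hc.mul (ih j hle)
      convert (h1.add h2).add h3 using 1
      linear_combination g (j + 1) * hg i - g j * hg (i + 1)

/-- Shifted sequences. -/
noncomputable def shiftc (G : ℕ → ℕ → Polynomial (Polynomial ℤ)) (n : ℕ) : ℕ → Polynomial (Polynomial ℤ)
  | 0 => 0
  | i + 1 => G i n

theorem main_TPc (G : ℕ → ℕ → Polynomial (Polynomial ℤ)) (c d : ℕ → Polynomial (Polynomial ℤ)) (hc : ∀ n, NNc (c n))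
    (hd : ∀ n, NNc (d n)) (h0 : ∀ n, G 0 n = 1) (h0' : ∀ m, G m 0 = 1)
    (hG : ∀ m n, G (m + 1) (n + 1) = G (m + 1) n + c n * G m (n + 1) + d n * G m n)
    (a b : ℕ) (hab : a ≤ b) : TPc (shiftc G a) (shiftc G b) := by
  have hrec : ∀ n j, shiftc G (n + 1) (j + 1) =
      shiftc G n (j + 1) + d n * shiftc G n j + c n * shiftc G (n + 1) j := by
    intro n j
    cases j with
    | zero => simp [shiftc, h0]
    | succ j => simp only [shiftc, hG]; ring
  have hself : ∀ n, TPc (shiftc G n) (shiftc G n) := by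
    intro n
    induction n with
    | zero =>
      intro i j hj
      rcases i with _ | i
      · obtain rfl : j = 0 := by omega
        simpa [shiftc] using NNc.zero
      · rcases j with _ | j
        · simpa [shiftc, h0'] using NNc.one
        · simpa [shiftc, h0'] using NNc.zero
    | succ n ih =>
      exact TPc.step_self (hc n) (hd n) rfl (hrec n)
        (TPc.step (hc n) (hd n) rfl rfl (hrec n) ih)
  induction b, hab using Nat.le_induction with
  | base => exact hself a
  | succ b _ ih => exact TPc.step (hc b) (hd b) rfl rfl (hrec b) ih

theorem overp_eq (m n k N : ℕ) :
    overp m n k N = ((boxA m n).filter fun x => (x.1.sum, x.2.card) = (N, k)).card := by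
  rw [overp, ← Fintype.card_coe, ← Nat.card_eq_fintype_card]
  refine Nat.card_congr
    { toFun := fun p => ⟨(p.1.1.parts, p.1.2), ?_⟩
      invFun := fun x => ⟨(⟨x.1.1, ?_, ?_⟩, x.1.2), ?_⟩
      left_inv := fun p => rfl
      right_inv := fun x => rfl }
  · obtain ⟨⟨p, T⟩, h1, h2, h3, h4⟩ := p
    rw [Finset.mem_filter, mem_boxA]
    refine ⟨⟨fun i hi => ⟨p.parts_pos hi, h1 i hi⟩, h2, h3⟩, ?_⟩
    rw [p.parts_sum, h4]
  · obtain ⟨⟨s, T⟩, h⟩ := x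
    rw [Finset.mem_filter, mem_boxA] at h
    exact fun {i} hi => (h.1.1 i hi).1
  · obtain ⟨⟨s, T⟩, h⟩ := x
    rw [Finset.mem_filter, mem_boxA] at h
    exact (Prod.mk.inj h.2).1
  · obtain ⟨⟨s, T⟩, h⟩ := x
    rw [Finset.mem_filter, mem_boxA] at h
    exact ⟨fun i hi => (h.1.1 i hi).2, h.1.2.1, h.1.2.2, (Prod.mk.inj h.2).2⟩

theorem OqtP_eq (a b : ℕ) : OqtP a b = boxG (X : Polynomial (Polynomial ℤ)) (C X) (a - b) b := by
  unfold OqtP boxG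
  generalize a - b = m
  rw [← Finset.sum_product', ← Finset.sum_fiberwise_of_maps_to
    (t := range (m * b + 1) ×ˢ range (b + 1)) (s := boxA m b) (g := fun x => (x.1.sum, x.2.card))]
  · refine Finset.sum_congr rfl ?_
    rintro ⟨N, k⟩ -
    rw [Finset.sum_congr rfl (g := fun _ => (C X : Polynomial (Polynomial ℤ)) ^ k * X ^ N), Finset.sum_const, overp_eq]
    · simp [mul_assoc]
    · rintro ⟨s, T⟩ h
      have := (Finset.mem_filter.1 h).2
      simp only [Prod.mk.injEq] at this
      rw [this.1, this.2]
  · rintro ⟨s, T⟩ h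
    rw [mem_boxA] at h
    obtain ⟨h1, h2, h3⟩ := h
    have e1 : s.sum ≤ m * b := by
      have := Multiset.sum_le_card_nsmul s m fun i hi => (h1 i hi).2
      rw [smul_eq_mul, mul_comm] at this
      exact this.trans (Nat.mul_le_mul_left m h2)
    have e2 : T.card ≤ b :=
      (Finset.card_le_card h3).trans ((Multiset.toFinset_card_le s).trans h2)
    simp only [Finset.mem_product, Finset.mem_range]
    omega

theorem stmt15 (n k : ℕ) (hk : 0 < k) (hkn : k < n) :
    ∀ N K : ℕ,
      0 ≤ ((OqtP n k ^ 2 - OqtP n (k - 1) * OqtP n (k + 1)).coeff N).coeff K := by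
  obtain ⟨k, rfl⟩ : ∃ j, k = j + 1 := ⟨k - 1, by omega⟩
  obtain ⟨m, rfl⟩ : ∃ m, n = k + 1 + (m + 1) := ⟨n - (k + 2), by omega⟩
  change NNc _
  simp only [OqtP_eq]
  rw [show k + 1 + (m + 1) - (k + 1) = m + 1 by omega,
    show k + 1 - 1 = k by omega, show k + 1 + (m + 1) - k = m + 2 by omega,
    show k + 1 + (m + 1) - (k + 1 + 1) = m by omega]
  set G := boxG (X : Polynomial (Polynomial ℤ)) (C X) with hGdef
  have hq : ∀ n, NNc (X ^ (n + 1)) := fun n => NNc.var.pow _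
  have ht : ∀ n, NNc (C X * X ^ (n + 1)) := fun n => NNc.CX.mul (NNc.var.pow _)
  have h1 := main_TPc G (fun n => X ^ (n + 1)) (fun n => C X * X ^ (n + 1)) hq ht
    (boxG_zero_left _ _) (boxG_zero_right _ _) (fun m n => boxG_rec' _ _ m n)
    k (k + 2) (by omega) (m + 2) (m + 1) (by omega)
  have h2 := main_TPc (fun m n => G n m) (fun n => X ^ (n + 1)) (fun n => C X * X ^ (n + 1)) hq ht
    (boxG_zero_right _ _) (boxG_zero_left _ _) (fun m n => boxG_rec _ _ n m)
    (m + 1) (m + 1) le_rfl (k + 2) (k + 1) (by omega)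
  convert h1.add h2 using 1
  simp only [shiftc]
  ring
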